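/- Let N ≥ 2 be an integer, let ρ₋, ρ₊, V₋, V₊, ω, γ > 0. For (α, β) ∈ (0, π)², define R₋(α) = (V₋/(ρ₋·ω·I₋(α)))^{1/N}, R₊(β) = (V₊/(ρ₊·ω·I₊(β)))^{1/N}, and F(α, β) = (N−1)·ρ₋·ω·R₋(α)^{N−1}·J₋(α) + (N−1)·ρ₊·ω·R₊(β)^{N−1}·J₊(β) + γ·ω·|R₋(α)^{N−1}·(sin α)^{N−1} − R₊(β)^{N−1}·(sin β)^{N−1}|. If (α, β) ∈ (0, π)² is a local minimum point of F and R₋(α)·sin α > R₊(β)·sin β, then ρ₋·cos α = γ and ρ₊·cos β = γ. -/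

import Mathlib

open Real

noncomputable def Im (N : ℕ) (α : ℝ) : ℝ := ∫ θ in α..π, sin θ ^ N

noncomputable def Jm (N : ℕ) (α : ℝ) : ℝ := ∫ θ in α..π, sin θ ^ (N - 2)

noncomputable def Ip (N : ℕ) (β : ℝ) : ℝ := ∫ θ in (0:ℝ)..β, sin θ ^ N

noncomputable def Jp (N : ℕ) (β : ℝ) : ℝ := ∫ θ in (0:ℝ)..β, sin θ ^ (N - 2)

noncomputable def Rm (N : ℕ) (ρm V ω α : ℝ) : ℝ := (V / (ρm * ω * Im N α)) ^ ((1 : ℝ) / N)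

noncomputable def Rp (N : ℕ) (ρp V ω β : ℝ) : ℝ := (V / (ρp * ω * Ip N β)) ^ ((1 : ℝ) / N)

noncomputable def F (N : ℕ) (ρm ρp Vm Vp ω γ : ℝ) (p : ℝ × ℝ) : ℝ :=
  ((N : ℝ) - 1) * ρm * ω * Rm N ρm Vm ω p.1 ^ (N - 1) * Jm N p.1 +
    ((N : ℝ) - 1) * ρp * ω * Rp N ρp Vp ω p.2 ^ (N - 1) * Jp N p.2 +
    γ * ω * |Rm N ρm Vm ω p.1 ^ (N - 1) * sin p.1 ^ (N - 1) -
      Rp N ρp Vp ω p.2 ^ (N - 1) * sin p.2 ^ (N - 1)|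

open Filter Topology

theorem Im_pos (N : ℕ) {α : ℝ} (h0 : 0 < α) (hπ : α < π) : 0 < Im N α := by
  refine intervalIntegral.intervalIntegral_pos_of_pos_on
    ((continuous_sin.pow N).intervalIntegrable _ _) (fun x hx => ?_) hπ
  exact pow_pos (sin_pos_of_pos_of_lt_pi (h0.trans hx.1) hx.2) N

theorem hasDerivAt_integral_sin_pow_left (k : ℕ) (α : ℝ) :
    HasDerivAt (fun x => ∫ θ in x..π, sin θ ^ k) (-sin α ^ k) α :=
  intervalIntegral.integral_hasDerivAt_left ((continuous_sin.pow k).intervalIntegrable _ _)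
    (continuous_sin.pow k).stronglyMeasurable.stronglyMeasurableAtFilter
    (continuous_sin.pow k).continuousAt

theorem integral_sin_pow_reflect (k : ℕ) (β : ℝ) :
    ∫ θ in (π - β)..π, sin θ ^ k = ∫ θ in (0:ℝ)..β, sin θ ^ k := by
  have h := intervalIntegral.integral_comp_sub_left (a := 0) (b := β) (fun θ => sin θ ^ k) π
  simpa [sin_pi_sub] using h.symm

theorem Jm_pi_sub (N : ℕ) (β : ℝ) : Jm N (π - β) = Jp N β :=
  integral_sin_pow_reflect (N - 2) β

theorem Rm_pi_sub (N : ℕ) (ρ V ω β : ℝ) : Rm N ρ V ω (π - β) = Rp N ρ V ω β := by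
  simp only [Rm, Rp, Im, Ip, integral_sin_pow_reflect]

theorem Rm_pos {N : ℕ} {ρ V ω α : ℝ} (hρ : 0 < ρ) (hV : 0 < V) (hω : 0 < ω)
    (h0 : 0 < α) (hπ : α < π) : 0 < Rm N ρ V ω α :=
  rpow_pos_of_pos (div_pos hV (mul_pos (mul_pos hρ hω) (Im_pos N h0 hπ))) _

theorem hasDerivAt_Rm {N : ℕ} {ρ V ω α : ℝ} (hρ : 0 < ρ) (hV : 0 < V) (hω : 0 < ω)
    (h0 : 0 < α) (hπ : α < π) :
    HasDerivAt (Rm N ρ V ω) (Rm N ρ V ω α * sin α ^ N / (N * Im N α)) α := by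
  have hI := Im_pos N h0 hπ
  have hD : 0 < ρ * ω * Im N α := mul_pos (mul_pos hρ hω) hI
  have hA : 0 < V / (ρ * ω * Im N α) := div_pos hV hD
  have hI' : HasDerivAt (Im N) (-sin α ^ N) α := hasDerivAt_integral_sin_pow_left N α
  have hA' := ((hI'.const_mul (ρ * ω)).fun_inv hD.ne').const_mul V
  have h := hA'.rpow_const (p := (1 : ℝ) / N) (Or.inl (by simpa [div_eq_mul_inv] using hA.ne'))
  simp only [← div_eq_mul_inv] at h
  refine h.congr_deriv ?_
  rw [rpow_sub_one hA.ne']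
  unfold Rm
  field_simp

theorem mul_Im_mul_cos_add_sin_pow_pos (N : ℕ) {α : ℝ} (h0 : 0 < α) (hπ : α < π) :
    0 < N * Im N α * cos α + sin α ^ (N + 1) := by
  have hs := sin_pos_of_pos_of_lt_pi h0 hπ
  have hint : ∫ θ in α..π, sin θ ^ N * cos θ = -(sin α ^ (N + 1) / (N + 1)) := by
    have hd (x : ℝ) : HasDerivAt (fun y => sin y ^ (N + 1) / ((N : ℝ) + 1))
        (sin x ^ N * cos x) x := by
      refine (((hasDerivAt_sin x).fun_pow (N + 1)).div_const ((N : ℝ) + 1)).congr_deriv ?_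
      rw [Nat.add_sub_cancel]
      push_cast
      field_simp
    rw [intervalIntegral.integral_eq_sub_of_hasDerivAt (fun x _ => hd x)
      (((continuous_sin.pow N).mul continuous_cos).intervalIntegrable _ _)]
    simp
  have hpos : 0 < ∫ θ in α..π, (sin θ ^ N * cos α - sin θ ^ N * cos θ) := by
    refine intervalIntegral.intervalIntegral_pos_of_pos_on
      (Continuous.intervalIntegrable (by fun_prop) _ _) (fun x hx => ?_) hπ
    have h1 := pow_pos (sin_pos_of_pos_of_lt_pi (h0.trans hx.1) hx.2) N
    have h2 := cos_lt_cos_of_nonneg_of_le_pi h0.le hx.2.le hx.1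
    rw [← mul_sub]
    exact mul_pos h1 (sub_pos.2 h2)
  rw [intervalIntegral.integral_sub (Continuous.intervalIntegrable (by fun_prop) _ _)
    (Continuous.intervalIntegrable (by fun_prop) _ _), intervalIntegral.integral_mul_const,
    hint] at hpos
  change 0 < Im N α * cos α - _ at hpos
  have hp := pow_pos hs (N + 1)
  have h3 : sin α ^ (N + 1) = (N + 1) * (sin α ^ (N + 1) / (N + 1)) := by field_simp
  set q := sin α ^ (N + 1) / ((N : ℝ) + 1) with hq
  have hq0 : 0 < q := by positivity
  have hN : (0 : ℝ) ≤ N := N.cast_nonneg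
  rw [h3]
  nlinarith [mul_nonneg hN hpos.le]

/-- The contribution of a single cap, with interface coefficient `γ` of either sign. -/
noncomputable def capEnergy (N : ℕ) (ρ V ω γ x : ℝ) : ℝ :=
  ((N : ℝ) - 1) * ρ * ω * Rm N ρ V ω x ^ (N - 1) * Jm N x +
    γ * ω * (Rm N ρ V ω x ^ (N - 1) * sin x ^ (N - 1))

theorem mul_cos_eq_of_isLocalMin_capEnergy {N : ℕ} (hN : 2 ≤ N) {ρ V ω γ α : ℝ}
    (hρ : 0 < ρ) (hV : 0 < V) (hω : 0 < ω) (h0 : 0 < α) (hπ : α < π)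
    (hmin : IsLocalMin (capEnergy N ρ V ω γ) α) : ρ * cos α = γ := by
  have hI := Im_pos N h0 hπ
  have hs := sin_pos_of_pos_of_lt_pi h0 hπ
  have hR := Rm_pos (N := N) hρ hV hω h0 hπ
  have hR' := hasDerivAt_Rm (N := N) hρ hV hω h0 hπ
  have hJ' : HasDerivAt (Jm N) (-sin α ^ (N - 2)) α := hasDerivAt_integral_sin_pow_left _ α
  have hkey := mul_Im_mul_cos_add_sin_pow_pos N h0 hπ
  obtain ⟨n, rfl⟩ := Nat.exists_eq_add_of_le' hN
  have hrec : ((n : ℝ) + 2) * Im (n + 2) α =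
      sin α ^ (n + 1) * cos α + (n + 1) * Jm (n + 2) α := by
    have h := integral_sin_pow (a := α) (b := π) (n := n)
    change Im (n + 2) α = _ + _ * Jm (n + 2) α at h
    rw [h]
    simp
    field_simp
  have hP := hR'.fun_pow (n + 2 - 1)
  have hd := (((hP.const_mul ((((n + 2 : ℕ) : ℝ) - 1) * ρ * ω)).mul hJ').add
    ((hP.mul ((hasDerivAt_sin α).fun_pow (n + 2 - 1))).const_mul (γ * ω)))
  have hz := hmin.hasDerivAt_eq_zero hd
  simp only [Nat.add_sub_cancel, show n + 2 - 1 = n + 1 from rfl] at hz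
  push_cast at hz hkey
  set R := Rm (n + 2) ρ V ω α
  set I := Im (n + 2) α
  set J := Jm (n + 2) α
  set s := sin α
  set c := cos α
  have hsc : s ^ 2 + c ^ 2 = 1 := sin_sq_add_cos_sq α
  have hJ : ((n : ℝ) + 1) * J = (n + 2) * I - s ^ (n + 1) * c := by linarith
  have hfac : ((n : ℝ) + 1) * ω * R ^ (n + 1) * s ^ n * (γ - ρ * c) *
      ((n + 2) * I * c + s ^ (n + 2 + 1)) = 0 := by
    field_simp at hz
    linear_combination hz - (n + 1) * ω * R ^ (n + 1) * s ^ n * ρ * s ^ 2 * hJ -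
      (n + 1) * ω * R ^ (n + 1) * s ^ n * ρ * ((n + 2) * I) * hsc
  have hn : (0 : ℝ) < n + 1 := by positivity
  have hne : ((n : ℝ) + 1) * ω * R ^ (n + 1) * s ^ n ≠ 0 := by positivity
  rcases mul_eq_zero.1 hfac with h | h
  · have := (mul_eq_zero.1 h).resolve_left hne
    linarith
  · exact absurd h hkey.ne'

theorem stmt_12 (N : ℕ) (hN : 2 ≤ N) (ρm ρp Vm Vp ω γ : ℝ)
    (hρm : 0 < ρm) (hρp : 0 < ρp) (hVm : 0 < Vm) (hVp : 0 < Vp) (hω : 0 < ω) (hγ : 0 < γ)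
    (α β : ℝ) (hαβ : (α, β) ∈ Set.Ioo (0:ℝ) π ×ˢ Set.Ioo (0:ℝ) π)
    (hmin : IsLocalMinOn (F N ρm ρp Vm Vp ω γ) (Set.Ioo (0:ℝ) π ×ˢ Set.Ioo (0:ℝ) π) (α, β))
    (hgt : Rm N ρm Vm ω α * sin α > Rp N ρp Vp ω β * sin β) :
    ρm * cos α = γ ∧ ρp * cos β = γ := by
  obtain ⟨⟨ha0, haπ⟩, hb0, hbπ⟩ : (0 < α ∧ α < π) ∧ 0 < β ∧ β < π := hαβ
  have hb0' : 0 < π - β := by linarith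
  have hbπ' : π - β < π := by linarith
  have hloc : IsLocalMin (F N ρm ρp Vm Vp ω γ) (α, β) :=
    hmin.isLocalMin ((isOpen_Ioo.prod isOpen_Ioo).mem_nhds ⟨⟨ha0, haπ⟩, hb0, hbπ⟩)
  have hloc' : IsLocalMin
      (fun p : ℝ × ℝ => F N ρm ρp Vm Vp ω γ (p.1, π - p.2)) (α, π - β) := by
    refine IsLocalMin.comp_continuous (f := F N ρm ρp Vm Vp ω γ)
      (g := fun p : ℝ × ℝ => (p.1, π - p.2)) (b := (α, π - β)) ?_ (by fun_prop)
    simpa using hloc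
  have hca : ContinuousAt (fun p : ℝ × ℝ => Rm N ρm Vm ω p.1 * sin p.1) (α, π - β) :=
    ContinuousAt.comp' (f := Prod.fst) (g := fun x => Rm N ρm Vm ω x * sin x)
      ((hasDerivAt_Rm hρm hVm hω ha0 haπ).continuousAt.mul continuous_sin.continuousAt)
      continuousAt_fst
  have hcb : ContinuousAt (fun p : ℝ × ℝ => Rm N ρp Vp ω p.2 * sin p.2) (α, π - β) :=
    ContinuousAt.comp' (f := Prod.snd) (g := fun x => Rm N ρp Vp ω x * sin x)
      ((hasDerivAt_Rm hρp hVp hω hb0' hbπ').continuousAt.mul continuous_sin.continuousAt)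
      continuousAt_snd
  have hlt : ∀ᶠ p : ℝ × ℝ in 𝓝 (α, π - β),
      Rm N ρp Vp ω p.2 * sin p.2 < Rm N ρm Vm ω p.1 * sin p.1 :=
    hcb.eventually_lt hca (by simpa [Rm_pi_sub, sin_pi_sub] using hgt)
  have hnonneg : ∀ᶠ p : ℝ × ℝ in 𝓝 (α, π - β), 0 < Rm N ρp Vp ω p.2 * sin p.2 :=
    hcb.eventually_const_lt
      (mul_pos (Rm_pos hρp hVp hω hb0' hbπ') (sin_pos_of_pos_of_lt_pi hb0' hbπ'))
  have heq : (fun p : ℝ × ℝ => F N ρm ρp Vm Vp ω γ (p.1, π - p.2)) =ᶠ[𝓝 (α, π - β)]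
      fun p => capEnergy N ρm Vm ω γ p.1 + capEnergy N ρp Vp ω (-γ) p.2 := by
    filter_upwards [hlt, hnonneg] with p hp hp0
    have hpow := pow_le_pow_left₀ hp0.le hp.le (N - 1)
    rw [mul_pow, mul_pow] at hpow
    simp only [F, capEnergy, ← Rm_pi_sub, ← Jm_pi_sub, sub_sub_cancel, sin_pi_sub]
    rw [abs_of_nonneg (sub_nonneg.2 hpow)]
    ring
  have hsum : IsLocalMin (fun p : ℝ × ℝ =>
      capEnergy N ρm Vm ω γ p.1 + capEnergy N ρp Vp ω (-γ) p.2) (α, π - β) :=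
    hloc'.congr heq
  constructor
  · refine mul_cos_eq_of_isLocalMin_capEnergy hN hρm hVm hω ha0 haπ ?_
    have h := IsLocalMin.comp_continuous (g := fun x : ℝ => (x, π - β)) hsum (by fun_prop)
    exact h.mono fun x hx => le_of_add_le_add_right hx
  · have hmin' : IsLocalMin (capEnergy N ρp Vp ω (-γ)) (π - β) := by
      have h := IsLocalMin.comp_continuous (g := fun y : ℝ => (α, y)) hsum (by fun_prop)
      exact h.mono fun x hx => le_of_add_le_add_left hx
    have h := mul_cos_eq_of_isLocalMin_capEnergy hN hρp hVp hω hb0' hbπ' hmin'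
    rw [cos_pi_sub] at h
    linarith
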